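/- The closing conditions propagate in time: if ∫₀^{2π} ((a+a'')/k)(θ,0)·sin θ dθ = 0 and ∫₀^{2π} ((a+a'')/k)(θ,0)·cos θ dθ = 0, then for every t ∈ [0,T₀) one has ∫₀^{2π} ((a+a'')/k)(θ,t)·sin θ dθ = 0 and ∫₀^{2π} ((a+a'')/k)(θ,t)·cos θ dθ = 0. -/

import Mathlib

open Real Set

noncomputable def wedge (x y : ℝ × ℝ) : ℝ := x.1 * y.2 - x.2 * y.1

noncomputable def er (θ : ℝ) : ℝ × ℝ := (Real.cos θ, Real.sin θ)

noncomputable def etheta (θ : ℝ) : ℝ × ℝ := (-Real.sin θ, Real.cos θ)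

/-- partial derivative in the first (spatial) variable -/
noncomputable def pd (f : ℝ → ℝ → ℝ) (θ t : ℝ) : ℝ := deriv (fun x => f x t) θ

/-- partial derivative in the second (time) variable -/
noncomputable def pt (f : ℝ → ℝ → ℝ) (θ t : ℝ) : ℝ := deriv (fun s => f θ s) t

/-- partial derivative in the first variable, vector valued -/
noncomputable def pdv (f : ℝ → ℝ → ℝ × ℝ) (θ t : ℝ) : ℝ × ℝ := deriv (fun x => f x t) θ

/-- partial derivative in the second variable, vector valued -/
noncomputable def ptv (f : ℝ → ℝ → ℝ × ℝ) (θ t : ℝ) : ℝ × ℝ := deriv (fun s => f θ s) t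

theorem hasDerivAt_pd {f : ℝ → ℝ → ℝ} (hf : ContDiff ℝ (⊤ : ℕ∞) (Function.uncurry f))
    (θ t : ℝ) : HasDerivAt (fun x => f x t) (pd f θ t) θ := by
  have h : Differentiable ℝ (fun x => f x t) :=
    (hf.comp (contDiff_id.prodMk contDiff_const)).differentiable (by simp)
  exact (h θ).hasDerivAt

theorem hasDerivAt_pt {f : ℝ → ℝ → ℝ} (hf : ContDiff ℝ (⊤ : ℕ∞) (Function.uncurry f))
    (θ t : ℝ) : HasDerivAt (fun s => f θ s) (pt f θ t) t := by
  have h : Differentiable ℝ (fun s => f θ s) :=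
    (hf.comp (contDiff_const.prodMk contDiff_id)).differentiable (by simp)
  exact (h t).hasDerivAt

theorem contDiff_pd {f : ℝ → ℝ → ℝ} (hf : ContDiff ℝ (⊤ : ℕ∞) (Function.uncurry f)) :
    ContDiff ℝ (⊤ : ℕ∞) (Function.uncurry (pd f)) := by
  have h : Function.uncurry (pd f) = fun p => fderiv ℝ (Function.uncurry f) p (1, 0) := by
    funext p
    have h₁ : HasDerivAt (fun x : ℝ => (x, p.2)) ((1 : ℝ), (0 : ℝ)) p.1 :=
      (hasDerivAt_id p.1).prodMk (hasDerivAt_const p.1 p.2)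
    have h₂ : HasFDerivAt (Function.uncurry f) (fderiv ℝ (Function.uncurry f) p) (p.1, p.2) :=
      (hf.differentiable (by simp) p).hasFDerivAt
    exact (h₂.comp_hasDerivAt p.1 h₁).deriv
  rw [h]
  exact (hf.fderiv_right (by simp)).clm_apply contDiff_const

theorem pd_periodic {f : ℝ → ℝ → ℝ} {c : ℝ} (hf : ∀ θ t, f (θ + c) t = f θ t) (θ t : ℝ) :
    pd f (θ + c) t = pd f θ t := by
  unfold pd
  rw [← deriv_comp_add_const (fun x => f x t) c θ]
  simp only [hf]

theorem pd_mul {f g : ℝ → ℝ → ℝ} (hf : ContDiff ℝ (⊤ : ℕ∞) (Function.uncurry f))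
    (hg : ContDiff ℝ (⊤ : ℕ∞) (Function.uncurry g)) :
    pd (fun θ t => f θ t * g θ t) = fun θ t => pd f θ t * g θ t + f θ t * pd g θ t := by
  funext θ t
  exact ((hasDerivAt_pd hf θ t).mul (hasDerivAt_pd hg θ t)).deriv

theorem pd_pd_mul {f g : ℝ → ℝ → ℝ} (hf : ContDiff ℝ (⊤ : ℕ∞) (Function.uncurry f))
    (hg : ContDiff ℝ (⊤ : ℕ∞) (Function.uncurry g)) (θ t : ℝ) :
    pd (pd (fun θ t => f θ t * g θ t)) θ t =
      pd (pd f) θ t * g θ t + 2 * (pd f θ t * pd g θ t) + f θ t * pd (pd g) θ t := by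
  rw [pd_mul hf hg]
  have h := ((hasDerivAt_pd (contDiff_pd hf) θ t).mul (hasDerivAt_pd hg θ t)).add
    ((hasDerivAt_pd hf θ t).mul (hasDerivAt_pd (contDiff_pd hg) θ t))
  refine h.deriv.trans ?_
  ring

/-- The range of the operator `u ↦ u'' + u` on periodic functions is orthogonal to its kernel. -/
theorem integral_pd_pd_add_self_mul_eq_zero {u : ℝ → ℝ → ℝ}
    (hu : ContDiff ℝ (⊤ : ℕ∞) (Function.uncurry u)) (huper : ∀ θ t, u (θ + 2 * π) t = u θ t)
    {φ ψ : ℝ → ℝ} (hφ : ∀ θ, HasDerivAt φ (ψ θ) θ) (hψ : ∀ θ, HasDerivAt ψ (-φ θ) θ)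
    (hφper : φ (2 * π) = φ 0) (hψper : ψ (2 * π) = ψ 0) (t : ℝ) :
    ∫ θ in (0:ℝ)..2 * π, (pd (pd u) θ t + u θ t) * φ θ = 0 := by
  have hφc : Continuous φ := continuous_iff_continuousAt.2 fun θ => (hφ θ).continuousAt
  have hderiv : ∀ θ ∈ uIcc 0 (2 * π), HasDerivAt (fun θ => pd u θ t * φ θ - u θ t * ψ θ)
      ((pd (pd u) θ t + u θ t) * φ θ) θ := fun θ _ => by
    refine (((hasDerivAt_pd (contDiff_pd hu) θ t).mul (hφ θ)).sub
      ((hasDerivAt_pd hu θ t).mul (hψ θ))).congr_deriv ?_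
    ring
  have hc₁ : Continuous fun θ => pd (pd u) θ t :=
    (contDiff_pd (contDiff_pd hu)).continuous.comp (by fun_prop : Continuous fun θ => (θ, t))
  have hc₂ : Continuous fun θ => u θ t :=
    hu.continuous.comp (by fun_prop : Continuous fun θ => (θ, t))
  rw [intervalIntegral.integral_eq_sub_of_hasDerivAt hderiv
    (((hc₁.add hc₂).mul hφc).intervalIntegrable _ _)]
  have h₁ := huper 0 t
  have h₂ := pd_periodic huper 0 t
  rw [zero_add] at h₁ h₂
  simp only [h₁, h₂, hφper, hψper, sub_self]

/-- If `∂f/∂t = -(u'' + u)` for `0 ≤ s ≤ t`, with `u` periodic in `θ`, then the integral of `f`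
against any solution `φ` of `φ'' + φ = 0` takes the same value at times `0` and `t`. -/
theorem integral_mul_eq_of_hasDerivAt {f u : ℝ → ℝ → ℝ} {t : ℝ} (ht : 0 ≤ t)
    (hu : ContDiff ℝ (⊤ : ℕ∞) (Function.uncurry u)) (huper : ∀ θ t, u (θ + 2 * π) t = u θ t)
    (hf : ∀ s ∈ Icc 0 t, Continuous fun θ => f θ s)
    (hft : ∀ θ, ∀ s ∈ Icc 0 t, HasDerivAt (fun s => f θ s) (-(pd (pd u) θ s + u θ s)) s)
    {φ ψ : ℝ → ℝ} (hφ : ∀ θ, HasDerivAt φ (ψ θ) θ) (hψ : ∀ θ, HasDerivAt ψ (-φ θ) θ)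
    (hφper : φ (2 * π) = φ 0) (hψper : ψ (2 * π) = ψ 0) :
    ∫ θ in (0:ℝ)..2 * π, f θ t * φ θ = ∫ θ in (0:ℝ)..2 * π, f θ 0 * φ θ := by
  have hφc : Continuous φ := continuous_iff_continuousAt.2 fun θ => (hφ θ).continuousAt
  have hG : Continuous (Function.uncurry fun θ s => -((pd (pd u) θ s + u θ s) * φ θ)) :=
    (((contDiff_pd (contDiff_pd hu)).continuous.add hu.continuous).mul
      (hφc.comp continuous_fst)).neg
  have hftc : ∀ θ, f θ t * φ θ - f θ 0 * φ θ =
      ∫ s in (0:ℝ)..t, -((pd (pd u) θ s + u θ s) * φ θ) := fun θ => by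
    refine (intervalIntegral.integral_eq_sub_of_hasDerivAt (f := fun s => f θ s * φ θ)
      (fun s hs => ?_) ?_).symm
    · rw [uIcc_of_le ht] at hs
      simpa only [neg_mul] using (hft θ s hs).mul_const (φ θ)
    · exact (hG.comp (by fun_prop : Continuous fun s => (θ, s))).intervalIntegrable _ _
  have hint : ∀ s ∈ Icc 0 t,
      IntervalIntegrable (fun θ => f θ s * φ θ) MeasureTheory.volume 0 (2 * π) :=
    fun s hs => ((hf s hs).mul hφc).intervalIntegrable _ _
  rw [← sub_eq_zero, ← intervalIntegral.integral_sub (hint t ⟨ht, le_rfl⟩) (hint 0 ⟨le_rfl, ht⟩)]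
  simp only [hftc]
  rw [MeasureTheory.intervalIntegral_intervalIntegral_swap]
  · simp only [intervalIntegral.integral_neg,
      integral_pd_pd_add_self_mul_eq_zero hu huper hφ hψ hφper hψper, neg_zero,
      intervalIntegral.integral_zero]
  · exact (hG.continuousOn.integrableOn_compact (isCompact_uIcc.prod isCompact_uIcc)).mono_set
      (prod_mono uIoc_subset_uIcc uIoc_subset_uIcc)

theorem stmt4
    (T : ℝ) (hT : 0 < T)
    (a : ℝ → ℝ → ℝ) (ha : ContDiff ℝ (⊤ : ℕ∞) (Function.uncurry a))
    (haper : ∀ θ t, a (θ + π) t = a θ t)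
    (hapos : ∀ θ t, t ∈ Set.Ico 0 T → 0 < a θ t)
    (haapos : ∀ θ t, t ∈ Set.Ico 0 T → 0 < a θ t + pd (pd a) θ t)
    (T₀ : ℝ) (hT₀ : 0 < T₀) (hT₀T : T₀ ≤ T)
    (k : ℝ → ℝ → ℝ) (hksm : ContDiff ℝ (⊤ : ℕ∞) (Function.uncurry k))
    (hkper : ∀ θ t, k (θ + 2 * π) t = k θ t)
    (hkpos : ∀ θ t, t ∈ Set.Ico 0 T₀ → 0 < k θ t)
    (hkevol : ∀ θ t, t ∈ Set.Ico 0 T₀ →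
      pt k θ t =
        a θ t / (a θ t + pd (pd a) θ t) * (k θ t) ^ 2 * pd (pd k) θ t
          + 2 * pd a θ t / (a θ t + pd (pd a) θ t) * (k θ t) ^ 2 * pd k θ t
          + (k θ t) ^ 3
          + pt (fun x s => Real.log (a x s + pd (pd a) x s)) θ t * k θ t)
    (hclose0 :
      (∫ θ in (0:ℝ)..2 * π, (a θ 0 + pd (pd a) θ 0) / k θ 0 * Real.sin θ) = 0 ∧
      (∫ θ in (0:ℝ)..2 * π, (a θ 0 + pd (pd a) θ 0) / k θ 0 * Real.cos θ) = 0) :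
    ∀ t ∈ Set.Ico 0 T₀,
      (∫ θ in (0:ℝ)..2 * π, (a θ t + pd (pd a) θ t) / k θ t * Real.sin θ) = 0 ∧
      (∫ θ in (0:ℝ)..2 * π, (a θ t + pd (pd a) θ t) / k θ t * Real.cos θ) = 0 := by
  intro t ht
  set A : ℝ → ℝ → ℝ := fun θ s => a θ s + pd (pd a) θ s with hA_def
  have hA : ContDiff ℝ (⊤ : ℕ∞) (Function.uncurry A) := ha.add (contDiff_pd (contDiff_pd ha))
  have hu : ContDiff ℝ (⊤ : ℕ∞) (Function.uncurry fun θ s => a θ s * k θ s) := ha.mul hksm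
  have huper : ∀ θ s, a (θ + 2 * π) s * k (θ + 2 * π) s = a θ s * k θ s := fun θ s => by
    rw [hkper, two_mul, ← add_assoc, haper, haper]
  have hmem : ∀ s ∈ Icc 0 t, s ∈ Ico 0 T₀ := fun s hs => ⟨hs.1, hs.2.trans_lt ht.2⟩
  have hcont : ∀ s ∈ Icc 0 t, Continuous fun θ => A θ s / k θ s := fun s hs =>
    (hA.continuous.comp (by fun_prop : Continuous fun θ => (θ, s))).div
      (hksm.continuous.comp (by fun_prop : Continuous fun θ => (θ, s)))
      fun θ => (hkpos θ s (hmem s hs)).ne'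
  have hderiv : ∀ θ, ∀ s ∈ Icc 0 t, HasDerivAt (fun s => A θ s / k θ s)
      (-(pd (pd fun θ s => a θ s * k θ s) θ s + a θ s * k θ s)) s := fun θ s hs => by
    have hs' := hmem s hs
    have hk0 : k θ s ≠ 0 := (hkpos θ s hs').ne'
    have hA0 : A θ s ≠ 0 := (haapos θ s ⟨hs'.1, hs'.2.trans_le hT₀T⟩).ne'
    have hlog : pt (fun x s => Real.log (A x s)) θ s = pt A θ s / A θ s :=
      ((hasDerivAt_pt hA θ s).log hA0).deriv
    refine ((hasDerivAt_pt hA θ s).div (hasDerivAt_pt hksm θ s) hk0).congr_deriv ?_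
    have hev : pt k θ s = a θ s / A θ s * (k θ s) ^ 2 * pd (pd k) θ s
        + 2 * pd a θ s / A θ s * (k θ s) ^ 2 * pd k θ s + (k θ s) ^ 3
        + pt (fun x s => Real.log (A x s)) θ s * k θ s := hkevol θ s hs'
    have haa : pd (pd a) θ s = A θ s - a θ s := by simp only [hA_def]; ring
    rw [hev, hlog, pd_pd_mul ha hksm, haa]
    field_simp
    ring
  constructor
  · exact (integral_mul_eq_of_hasDerivAt ht.1 hu huper hcont hderiv Real.hasDerivAt_sin
      Real.hasDerivAt_cos (by simp) (by simp)).trans hclose0.1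
  · exact (integral_mul_eq_of_hasDerivAt ht.1 hu huper hcont hderiv Real.hasDerivAt_cos
      (fun θ => (Real.hasDerivAt_sin θ).neg) (by simp) (by simp)).trans hclose0.2
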